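/- arXiv:2210.14016 — 5 statements merged into one kernel-verified Lean document; each statement's English description precedes it below -/
import Mathlib

section
/- Distribution of offspring error under uniform crossover: let Opt, A, B be n × n matrices with Boolean entries, let k = d_e(A,B), and let m be the number of pairs (i,j) with i ≠ j, A i j = B i j, and A i j ≠ Opt i j. When the choice mask c is drawn uniformly at random from all functions Fin n → Fin n → Bool, the distribution of d_e(Opt, rec c A B) equals the distribution of m + X, where X is a binomial random variable with k trials and success probability 1/2. -/
open Finset

/-- `de A B`: the number of off-diagonal pairs `(i,j)` with `i ≠ j` and `A i j ≠ B i j`. -/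
def de {n : ℕ} (A B : Fin n → Fin n → Bool) : ℕ :=
  (Finset.univ.filter fun p : Fin n × Fin n => p.1 ≠ p.2 ∧ A p.1 p.2 ≠ B p.1 p.2).card

/-- Elementwise recombination (crossover): the `(i,j)` entry of `recomb c A B`
is `A i j` if `c i j = true` and `B i j` otherwise. -/
def recomb {n : ℕ} (c : Fin n → Fin n → Bool) (A B : Fin n → Fin n → Bool) :
    Fin n → Fin n → Bool :=
  fun i j => if c i j then A i j else B i j



/-- The number of subsets whose intersection with `D` has `j` elements. -/
lemma card_inter_count {α : Type*} [Fintype α] [DecidableEq α] (D : Finset α) (j : ℕ) :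
    (Finset.univ.filter fun S : Finset α => (S ∩ D).card = j).card =
      D.card.choose j * 2 ^ (Fintype.card α - D.card) := by
  rw [← Finset.card_compl, ← Finset.card_powerset, ← Finset.card_powersetCard,
    ← Finset.card_product]
  refine Finset.card_nbij' (fun S => (S ∩ D, S ∩ Dᶜ)) (fun q => q.1 ∪ q.2) ?_ ?_ ?_ ?_
  · intro S hS
    simp only [Finset.coe_filter, Finset.mem_univ, true_and, Set.mem_ofPred_eq] at hS
    simp [Finset.mem_powersetCard, hS]
  · rintro ⟨U, V⟩ h
    simp only [Finset.mem_coe, Finset.mem_product, Finset.mem_powersetCard,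
      Finset.mem_powerset] at h
    obtain ⟨⟨hU, hc⟩, hV⟩ := h
    have : (U ∪ V) ∩ D = U := by
      ext x
      have h1 := @hU x
      have h2 := @hV x
      simp only [Finset.mem_compl] at h2
      simp only [Finset.mem_inter, Finset.mem_union]
      tauto
    simp [this, hc]
  · intro S _
    ext x
    simp only [Finset.mem_inter, Finset.mem_union, Finset.mem_compl]
    tauto
  · rintro ⟨U, V⟩ h
    simp only [Finset.mem_coe, Finset.mem_product, Finset.mem_powersetCard,
      Finset.mem_powerset] at h
    obtain ⟨⟨hU, hc⟩, hV⟩ := h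
    ext x
    · have h1 := @hU x
      have h2 := @hV x
      simp only [Finset.mem_compl] at h2
      simp only [Finset.mem_inter, Finset.mem_union]
      tauto
    · have h1 := @hU x
      have h2 := @hV x
      simp only [Finset.mem_compl] at h2
      simp only [Finset.mem_inter, Finset.mem_union, Finset.mem_compl]
      tauto

/-- The off-diagonal positions where `A` and `B` differ. -/
def diffSet {n : ℕ} (A B : Fin n → Fin n → Bool) : Finset (Fin n × Fin n) :=
  Finset.univ.filter fun p : Fin n × Fin n => p.1 ≠ p.2 ∧ A p.1 p.2 ≠ B p.1 p.2

/-- The positions where the mask makes the erroneous choice. -/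
def badSet {n : ℕ} (Opt A c : Fin n → Fin n → Bool) : Finset (Fin n × Fin n) :=
  Finset.univ.filter fun p : Fin n × Fin n => c p.1 p.2 = (A p.1 p.2 != Opt p.1 p.2)

lemma badSet_count {n : ℕ} (Opt A : Fin n → Fin n → Bool) (P : Finset (Fin n × Fin n) → Prop)
    [DecidablePred P] :
    (Finset.univ.filter fun c : Fin n → Fin n → Bool => P (badSet Opt A c)).card =
      (Finset.univ.filter P).card := by
  refine Finset.card_nbij' (badSet Opt A)
    (fun S i j => decide ((i, j) ∈ S) == (A i j != Opt i j)) ?_ ?_ ?_ ?_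
  · intro c hc
    simpa using hc
  · intro S hS
    have : badSet Opt A (fun i j => decide ((i, j) ∈ S) == (A i j != Opt i j)) = S := by
      ext ⟨i, j⟩
      by_cases h : (i, j) ∈ S <;> cases hA : A i j <;> cases hO : Opt i j <;>
        simp [badSet, h, hA, hO]
    simp only [Finset.coe_filter, Finset.mem_univ, true_and, Set.mem_ofPred_eq] at hS ⊢
    rwa [this]
  · intro c _
    funext i j
    cases hA : A i j <;> cases hO : Opt i j <;> cases hc : c i j <;>
      simp [badSet, hA, hO, hc]
  · intro S _
    ext ⟨i, j⟩
    by_cases h : (i, j) ∈ S <;> cases hA : A i j <;> cases hO : Opt i j <;>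
        simp [badSet, h, hA, hO]

lemma de_recomb {n : ℕ} (Opt A B c : Fin n → Fin n → Bool) :
    de Opt (recomb c A B) = (Finset.univ.filter fun p : Fin n × Fin n =>
      p.1 ≠ p.2 ∧ A p.1 p.2 = B p.1 p.2 ∧ A p.1 p.2 ≠ Opt p.1 p.2).card +
      (badSet Opt A c ∩ diffSet A B).card := by
  rw [← Finset.card_union_of_disjoint]
  · unfold de
    congr 1
    ext ⟨i, j⟩
    simp only [Finset.mem_union, Finset.mem_inter, badSet, diffSet, Finset.mem_filter]
    by_cases h : i = j <;> cases hA : A i j <;> cases hO : Opt i j <;> cases hc : c i j <;>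
      cases hB : B i j <;> simp [recomb, h, hA, hO, hc, hB]
  · rw [Finset.disjoint_left]
    rintro p h1 h2
    simp only [Finset.mem_filter, diffSet, Finset.mem_inter] at h1 h2
    exact h2.2.2.2 h1.2.2.1

/-- Distribution of the offspring error under uniform crossover: with
`k = d_e(A,B)` and `m` the number of off-diagonal positions where `A` and `B`
agree but differ from `Opt`, the distribution of `d_e(Opt, rec c A B)` under a
uniformly random choice mask `c` is that of `m + X` with `X ∼ Binomial(k, 1/2)`. -/
theorem crossover_offspring_error_distribution {n : ℕ}
    (Opt A B : Fin n → Fin n → Bool) (k m : ℕ)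
    (hk : k = de A B)
    (hm : m = (Finset.univ.filter fun p : Fin n × Fin n =>
      p.1 ≠ p.2 ∧ A p.1 p.2 = B p.1 p.2 ∧ A p.1 p.2 ≠ Opt p.1 p.2).card) :
    PMF.map (fun c : Fin n → Fin n → Bool => de Opt (recomb c A B))
        (PMF.uniformOfFintype (Fin n → Fin n → Bool)) =
      PMF.map (fun x : Fin (k + 1) => m + (x : ℕ))
        (PMF.binomial 2⁻¹ (by norm_num) k) := by
  classical
  have hkD : k = (diffSet A B).card := hk
  have hkle : k ≤ Fintype.card (Fin n × Fin n) := hkD ▸ Finset.card_le_univ _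
  have hcard : Fintype.card (Fin n → Fin n → Bool) = 2 ^ Fintype.card (Fin n × Fin n) := by
    simp [pow_mul]
  ext y
  rw [PMF.map_apply, PMF.map_apply, tsum_fintype, tsum_fintype]
  simp only [PMF.uniformOfFintype_apply, de_recomb, ← hm]
  rw [← Finset.sum_filter, Finset.sum_const, nsmul_eq_mul]
  rcases lt_or_ge y m with hy | hy
  · rw [Finset.filter_false_of_mem (by intros; omega), Finset.sum_eq_zero]
    · simp
    · intro x _
      rw [if_neg (by omega)]
  obtain ⟨j, rfl⟩ := Nat.exists_eq_add_of_le hy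
  have hcount := badSet_count Opt A (fun S => (S ∩ diffSet A B).card = j)
  rw [card_inter_count, ← hkD] at hcount
  have hfil : (Finset.univ.filter fun c : Fin n → Fin n → Bool =>
      m + j = m + (badSet Opt A c ∩ diffSet A B).card) =
      Finset.univ.filter fun c => (badSet Opt A c ∩ diffSet A B).card = j := by
    ext c
    simp only [Finset.mem_filter, Nat.add_left_cancel_iff, eq_comm]
  rw [hfil, hcount, hcard]
  rcases lt_or_ge k j with hj | hj
  · rw [Nat.choose_eq_zero_of_lt hj, Finset.sum_eq_zero]
    · simp
    · intro x _
      rw [if_neg (by omega)]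
  rw [Finset.sum_eq_single (⟨j, by omega⟩ : Fin (k + 1))]
  · rw [if_pos rfl, PMF.binomial_apply]
    obtain ⟨r, hr⟩ := Nat.exists_eq_add_of_le hkle
    have h2 : (1 - 2⁻¹ : ENNReal) = 2⁻¹ := ENNReal.one_sub_inv_two
    have hrr : k + r - k = r := by omega
    have hc : ((2 : NNReal)⁻¹ : NNReal) = ((2 : ENNReal)⁻¹) := by simp
    rw [hr, hrr]
    simp only [hc, h2, Fin.val_last, ← pow_add]
    rw [show j + (k - j) = k by omega]
    push_cast
    rw [pow_add, ENNReal.mul_inv (by simp) (by simp), ← ENNReal.inv_pow (n := k)]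
    have : (2 : ENNReal) ^ r * (2 ^ r)⁻¹ = 1 := ENNReal.mul_inv_cancel (by simp) (by simp)
    calc _ = (2 ^ k : ENNReal)⁻¹ * (k.choose j) * ((2 : ENNReal) ^ r * (2 ^ r)⁻¹) := by ring
      _ = _ := by rw [this, mul_one]
  · intro x _ hx
    rw [if_neg]
    intro h
    exact hx (Fin.ext (by simp; omega))
  · simp
end

section
/- Expected improvement of crossover between matched parents: let Opt, A, B be n × n matrices with Boolean entries, let k = d_e(A,B), and let Δ be the number of pairs (i,j) with i ≠ j, A i j ≠ B i j, and A i j ≠ Opt i j. When the choice mask c is drawn uniformly at random from all functions Fin n → Fin n → Bool, the expected value of max(d_e(Opt, A) − d_e(Opt, rec c A B), 0) equals ∑_{x=0}^{k} (C(k,x) / 2^k) · max(Δ − x, 0). -/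
open Finset MeasureTheory

theorem sum_inter_card {ι : Type*} [Fintype ι] [DecidableEq ι] (D : Finset ι) (f : ℕ → ℝ) :
    ∑ s : Finset ι, f (D ∩ s).card =
      2 ^ (Dᶜ.card) * ∑ x ∈ Finset.range (D.card + 1), (D.card.choose x : ℝ) * f x := by
  have h1 : ∑ s : Finset ι, f (D ∩ s).card =
      ∑ q ∈ D.powerset ×ˢ Dᶜ.powerset, f q.1.card := by
    refine Finset.sum_nbij' (fun s => (D ∩ s, Dᶜ ∩ s)) (fun q => q.1 ∪ q.2) ?_ ?_ ?_ ?_ ?_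
    · intro s _
      simp [Finset.inter_subset_left]
    · intro q _
      simp
    · intro s _
      ext x
      simp only [mem_union, mem_inter, mem_compl]
      tauto
    · rintro ⟨t, u⟩ hq
      simp only [mem_product, mem_powerset] at hq
      obtain ⟨ht, hu⟩ := hq
      have hu' : ∀ x ∈ u, x ∉ D := fun x hx => by simpa using hu hx
      ext x
      · have := @ht x
        have := hu' x
        simp only [mem_union, mem_inter]
        tauto
      · have := @ht x
        have := hu' x
        simp only [mem_union, mem_inter, mem_compl]
        tauto
    · intro s _
      rfl
  rw [h1, Finset.sum_product]
  simp only [Finset.sum_const, Finset.card_powerset, nsmul_eq_mul]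
  rw [← Finset.mul_sum, Finset.sum_powerset_apply_card (fun m => f m)]
  simp

theorem sum_mask {n : ℕ} (w : Fin n → Fin n → Bool) (g : Finset (Fin n × Fin n) → ℝ) :
    ∑ c : Fin n → Fin n → Bool, g (Finset.univ.filter fun p => c p.1 p.2 = w p.1 p.2) =
      ∑ s : Finset (Fin n × Fin n), g s := by
  refine Finset.sum_nbij' (fun c => Finset.univ.filter fun p => c p.1 p.2 = w p.1 p.2)
    (fun s i j => if (i, j) ∈ s then w i j else !(w i j)) ?_ ?_ ?_ ?_ ?_
  · intro c _
    simp
  · intro c _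
    simp
  · intro c _
    funext i j
    by_cases h : c i j = w i j
    · simp [h]
    · simp only [mem_filter, mem_univ, true_and, h, if_false]
      revert h
      cases c i j <;> cases w i j <;> simp
  · intro s _
    ext ⟨i, j⟩
    by_cases h : (i, j) ∈ s <;> simp [h]
  · intro c _
    rfl

theorem diff_eq {n : ℕ} (Opt A B c : Fin n → Fin n → Bool) :
    (de Opt A : ℤ) - (de Opt (recomb c A B) : ℤ) =
      ((Finset.univ.filter fun p : Fin n × Fin n =>
        p.1 ≠ p.2 ∧ A p.1 p.2 ≠ B p.1 p.2 ∧ A p.1 p.2 ≠ Opt p.1 p.2).card : ℤ) -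
      (((Finset.univ.filter fun p : Fin n × Fin n => p.1 ≠ p.2 ∧ A p.1 p.2 ≠ B p.1 p.2) ∩
        (Finset.univ.filter fun p : Fin n × Fin n =>
          c p.1 p.2 = (A p.1 p.2 != Opt p.1 p.2))).card : ℤ) := by
  rw [← Finset.filter_and]
  unfold de recomb
  simp only [Finset.card_filter, Nat.cast_sum]
  rw [← Finset.sum_sub_distrib, ← Finset.sum_sub_distrib]
  refine Finset.sum_congr rfl fun p _ => ?_
  by_cases h : p.1 = p.2
  · simp [h]
  · cases A p.1 p.2 <;> cases B p.1 p.2 <;> cases Opt p.1 p.2 <;> cases c p.1 p.2 <;> simp [h]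

/-- Expected improvement of crossover between matched parents: with
`k = d_e(A,B)` and `Δ` the number of off-diagonal positions where `A` and `B`
differ and `A` is wrong (differs from `Opt`), the expectation of
`max(d_e(Opt,A) − d_e(Opt, rec c A B), 0)` under a uniformly random choice mask
`c` equals `∑_{x=0}^{k} (C(k,x)/2^k)·max(Δ − x, 0)`. -/
theorem crossover_expected_improvement {n : ℕ}
    (Opt A B : Fin n → Fin n → Bool) (k Δ : ℕ)
    (hk : k = de A B)
    (hΔ : Δ = (Finset.univ.filter fun p : Fin n × Fin n =>
      p.1 ≠ p.2 ∧ A p.1 p.2 ≠ B p.1 p.2 ∧ A p.1 p.2 ≠ Opt p.1 p.2).card) :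
    ∫ c : Fin n → Fin n → Bool,
        ((max ((de Opt A : ℤ) - (de Opt (recomb c A B) : ℤ)) 0 : ℤ) : ℝ)
        ∂(PMF.uniformOfFintype (Fin n → Fin n → Bool)).toMeasure =
      ∑ x ∈ Finset.range (k + 1),
        ((k.choose x : ℝ) / 2 ^ k) * ((max ((Δ : ℤ) - (x : ℤ)) 0 : ℤ) : ℝ) := by
  rw [PMF.integral_eq_sum]
  simp only [PMF.uniformOfFintype_apply, diff_eq, ← hΔ, smul_eq_mul]
  rw [← Finset.mul_sum]
  rw [sum_mask (fun i j => (A i j != Opt i j)) (fun s => ((max ((Δ : ℤ) -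
    (((Finset.univ.filter fun p : Fin n × Fin n => p.1 ≠ p.2 ∧ A p.1 p.2 ≠ B p.1 p.2) ∩
      s).card : ℤ)) 0 : ℤ) : ℝ))]
  rw [sum_inter_card _ (fun x => ((max ((Δ : ℤ) - (x : ℤ)) 0 : ℤ) : ℝ))]
  have hk' : (Finset.univ.filter fun p : Fin n × Fin n =>
    p.1 ≠ p.2 ∧ A p.1 p.2 ≠ B p.1 p.2).card = k := hk.symm
  have hc := Finset.card_add_card_compl (Finset.univ.filter fun p : Fin n × Fin n =>
    p.1 ≠ p.2 ∧ A p.1 p.2 ≠ B p.1 p.2)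
  rw [hk'] at hc ⊢
  have hN : (Fintype.card (Fin n → Fin n → Bool)) = 2 ^ Fintype.card (Fin n × Fin n) := by
    simp [← pow_mul]
  rw [hN, ← hc, ← mul_assoc, Finset.mul_sum]
  refine Finset.sum_congr rfl fun x _ => ?_
  rw [← mul_assoc]
  congr 1
  simp only [ENNReal.toReal_inv, ENNReal.toReal_natCast, pow_add, Nat.cast_mul,
    Nat.cast_pow, Nat.cast_ofNat]
  rw [ENNReal.toReal_mul]
  simp only [ENNReal.toReal_pow, ENNReal.toReal_ofNat]
  field_simp
end

section
/- Expected off-diagonal disagreement under a random permutation of one parent: let A, B be n × n matrices with Boolean entries, n ≥ 2, let a₁ be the number of pairs (i,j) with i ≠ j and A i j = true, a₀ = n(n−1) − a₁, and define b₁, b₀ analogously for B. If π is drawn uniformly at random from the permutations of Fin n, then the expected value of d_e(A, B^π) equals (a₁·b₀ + a₀·b₁) / (n(n−1)). -/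
open Finset MeasureTheory

/-- Permutations of `Fin n` form a finite type; equip them with the discrete
(⊤) measurable-space structure. -/
instance {n : ℕ} : MeasurableSpace (Equiv.Perm (Fin n)) := ⊤

/-- Conjugation of a matrix `B` by a permutation `σ`: `(B^σ) i j = B (σ i) (σ j)`. -/
def conj {n : ℕ} (σ : Equiv.Perm (Fin n)) (B : Fin n → Fin n → Bool) :
    Fin n → Fin n → Bool :=
  fun i j => B (σ i) (σ j)

theorem exists_perm_pair {n : ℕ} (p q : Fin n × Fin n) (hp : p.1 ≠ p.2) (hq : q.1 ≠ q.2) :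
    ∃ τ : Equiv.Perm (Fin n), τ p.1 = q.1 ∧ τ p.2 = q.2 := by
  refine ⟨Equiv.swap (Equiv.swap p.1 q.1 p.2) q.2 * Equiv.swap p.1 q.1, ?_, ?_⟩
  · rw [Equiv.Perm.mul_apply, Equiv.swap_apply_left]
    apply Equiv.swap_apply_of_ne_of_ne _ hq
    intro h
    apply hp
    apply (Equiv.swap p.1 q.1).injective
    rw [Equiv.swap_apply_left, ← h]
  · rw [Equiv.Perm.mul_apply, Equiv.swap_apply_left]

theorem sum_perm_pair {n : ℕ} (f : Fin n × Fin n → ℝ) (p : Fin n × Fin n) (hp : p.1 ≠ p.2) :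
    ((n * (n - 1) : ℕ) : ℝ) * ∑ π : Equiv.Perm (Fin n), f (π p.1, π p.2) =
      (Fintype.card (Equiv.Perm (Fin n)) : ℝ) * ∑ q ∈ (univ : Finset (Fin n)).offDiag, f q := by
  have hcard : (univ : Finset (Fin n)).offDiag.card = n * (n - 1) := by
    rw [Finset.offDiag_card, Finset.card_univ, Fintype.card_fin, Nat.mul_sub, Nat.mul_one]
  have h1 : ∀ q ∈ (univ : Finset (Fin n)).offDiag,
      ∑ π : Equiv.Perm (Fin n), f (π q.1, π q.2) = ∑ π : Equiv.Perm (Fin n), f (π p.1, π p.2) := by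
    intro q hq
    obtain ⟨τ, h1, h2⟩ := exists_perm_pair p q hp (by simpa using hq)
    rw [← Equiv.sum_comp (Equiv.mulRight τ) (fun π : Equiv.Perm (Fin n) => f (π p.1, π p.2))]
    simp [h1, h2]
  have h2 : ∀ π : Equiv.Perm (Fin n), ∑ q ∈ (univ : Finset (Fin n)).offDiag, f (π q.1, π q.2) =
      ∑ q ∈ (univ : Finset (Fin n)).offDiag, f q := by
    intro π
    apply Finset.sum_equiv (Equiv.prodCongr π π)
    · intro i; simp
    · intro i _; simp [Prod.map]
  rw [← hcard, ← nsmul_eq_mul, ← Finset.sum_const, ← Finset.sum_congr rfl h1, Finset.sum_comm,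
    Finset.sum_congr rfl (fun π _ => h2 π), Finset.sum_const, nsmul_eq_mul, Finset.card_univ]

theorem card_offDiag_true {n : ℕ} (A : Fin n → Fin n → Bool) :
    (((Finset.univ.filter fun p : Fin n × Fin n => p.1 ≠ p.2 ∧ A p.1 p.2 = true).card : ℕ) : ℝ) =
      ∑ p ∈ (univ : Finset (Fin n)).offDiag, (if A p.1 p.2 = true then (1 : ℝ) else 0) := by
  rw [Finset.sum_boole]
  congr 2
  ext p
  simp

theorem de_eq_sum {n : ℕ} (A B : Fin n → Fin n → Bool) :
    (de A B : ℝ) = ∑ p ∈ (univ : Finset (Fin n)).offDiag,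
      ((if A p.1 p.2 = true then (1 : ℝ) else 0) +
        (1 - 2 * (if A p.1 p.2 = true then (1 : ℝ) else 0)) *
          (if B p.1 p.2 = true then (1 : ℝ) else 0)) := by
  have : (de A B : ℝ) = ∑ p ∈ (univ : Finset (Fin n)).offDiag,
      (if A p.1 p.2 ≠ B p.1 p.2 then (1 : ℝ) else 0) := by
    rw [Finset.sum_boole, de]
    congr 2
    ext p
    simp
  rw [this]
  apply Finset.sum_congr rfl
  intro p _
  cases A p.1 p.2 <;> cases B p.1 p.2 <;> norm_num

theorem card_true_le {n : ℕ} (A : Fin n → Fin n → Bool) :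
    (Finset.univ.filter fun p : Fin n × Fin n => p.1 ≠ p.2 ∧ A p.1 p.2 = true).card
      ≤ n * (n - 1) := by
  have hcard : (univ : Finset (Fin n)).offDiag.card = n * (n - 1) := by
    rw [Finset.offDiag_card, Finset.card_univ, Fintype.card_fin, Nat.mul_sub, Nat.mul_one]
  rw [← hcard]
  apply Finset.card_le_card
  intro p
  simp
  tauto

/-- Expected off-diagonal disagreement under a random permutation of one parent:
with `a₁`, `b₁` the numbers of off-diagonal `true` entries of `A`, `B` and
`a₀ = n(n−1) − a₁`, `b₀ = n(n−1) − b₁`, the expectation of `d_e(A, B^π)` for a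
uniformly random permutation `π` equals `(a₁·b₀ + a₀·b₁)/(n(n−1))`. -/
theorem expected_de_random_permutation {n : ℕ} (hn : 2 ≤ n)
    (A B : Fin n → Fin n → Bool) (a₁ a₀ b₁ b₀ : ℕ)
    (ha₁ : a₁ = (Finset.univ.filter fun p : Fin n × Fin n =>
      p.1 ≠ p.2 ∧ A p.1 p.2 = true).card)
    (ha₀ : a₀ = n * (n - 1) - a₁)
    (hb₁ : b₁ = (Finset.univ.filter fun p : Fin n × Fin n =>
      p.1 ≠ p.2 ∧ B p.1 p.2 = true).card)
    (hb₀ : b₀ = n * (n - 1) - b₁) :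
    ∫ π : Equiv.Perm (Fin n), (de A (conj π B) : ℝ)
        ∂(PMF.uniformOfFintype (Equiv.Perm (Fin n))).toMeasure =
      ((a₁ * b₀ + a₀ * b₁ : ℕ) : ℝ) / ((n * (n - 1) : ℕ) : ℝ) := by
  have hcard : (univ : Finset (Fin n)).offDiag.card = n * (n - 1) := by
    rw [Finset.offDiag_card, Finset.card_univ, Fintype.card_fin, Nat.mul_sub, Nat.mul_one]
  have hA := card_true_le A
  have hB := card_true_le B
  rw [← ha₁] at hA
  rw [← hb₁] at hB
  have hA' := card_offDiag_true A
  have hB' := card_offDiag_true B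
  rw [← ha₁] at hA'
  rw [← hb₁] at hB'
  have hNpos : 0 < n * (n - 1) := Nat.mul_pos (by omega) (by omega)
  have ha₀' : (a₀ : ℝ) = ((n * (n - 1) : ℕ) : ℝ) - a₁ := by rw [ha₀, Nat.cast_sub hA]
  have hb₀' : (b₀ : ℝ) = ((n * (n - 1) : ℕ) : ℝ) - b₁ := by rw [hb₀, Nat.cast_sub hB]
  have hint : ∫ π : Equiv.Perm (Fin n), (de A (conj π B) : ℝ)
        ∂(PMF.uniformOfFintype (Equiv.Perm (Fin n))).toMeasure =
      (Fintype.card (Equiv.Perm (Fin n)) : ℝ)⁻¹ *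
        ∑ π : Equiv.Perm (Fin n), (de A (conj π B) : ℝ) := by
    have : MeasurableSingletonClass (Equiv.Perm (Fin n)) := ⟨fun _ => trivial⟩
    rw [PMF.integral_eq_sum, Finset.mul_sum]
    simp
  have hF : (0 : ℝ) < (Fintype.card (Equiv.Perm (Fin n)) : ℝ) := by
    exact_mod_cast Fintype.card_pos
  rw [hint]
  rw [Nat.cast_add, Nat.cast_mul a₁, Nat.cast_mul a₀]
  rw [ha₀', hb₀']
  have hN : (0 : ℝ) < ((n * (n - 1) : ℕ) : ℝ) := by exact_mod_cast hNpos
  have key : ∑ π : Equiv.Perm (Fin n), (de A (conj π B) : ℝ) =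
      ∑ p ∈ (univ : Finset (Fin n)).offDiag,
        ((if A p.1 p.2 = true then (1 : ℝ) else 0) * Fintype.card (Equiv.Perm (Fin n)) +
        (1 - 2 * (if A p.1 p.2 = true then (1 : ℝ) else 0)) *
          (Fintype.card (Equiv.Perm (Fin n)) * b₁ / ((n * (n - 1) : ℕ) : ℝ))) := by
    simp_rw [de_eq_sum]
    rw [Finset.sum_comm]
    apply Finset.sum_congr rfl
    intro p hp
    have := sum_perm_pair (fun q => if B q.1 q.2 = true then (1 : ℝ) else 0) p (by simpa using hp)
    rw [← hB'] at this
    rw [← this, mul_div_cancel_left₀ _ hN.ne', Finset.sum_add_distrib, ← Finset.mul_sum,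
      Finset.sum_const, nsmul_eq_mul, Finset.card_univ, mul_comm (Fintype.card _ : ℝ)]
    rfl
  rw [key, Finset.sum_add_distrib, ← Finset.sum_mul, ← Finset.sum_mul, Finset.sum_sub_distrib,
    ← Finset.mul_sum, ← hA', Finset.sum_const, hcard, nsmul_eq_mul]
  generalize ((n * (n - 1) : ℕ) : ℝ) = N at *
  generalize (Fintype.card (Equiv.Perm (Fin n)) : ℝ) = F at *
  push_cast
  field_simp
  ring
end

section
/- Expected count of positions where a randomly permuted parent confirms an error: let Opt, A, B be n × n matrices with Boolean entries, n ≥ 2; let w₁ be the number of pairs (i,j) with i ≠ j, A i j = true and Opt i j = false, w₀ the number with i ≠ j, A i j = false and Opt i j = true, b₁ the number of pairs (i,j) with i ≠ j and B i j = true, and b₀ = n(n−1) − b₁. If π is drawn uniformly at random from the permutations of Fin n, then the expected number of pairs (i,j) with i ≠ j, A i j = (B^π) i j, and A i j ≠ Opt i j equals (w₁·b₁ + w₀·b₀) / (n(n−1)). -/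
open Finset MeasureTheory

/-- Off-diagonal entries of `B` equal to `v`. -/
def offCount {n : ℕ} (B : Fin n → Fin n → Bool) (v : Bool) : ℕ :=
  ∑ q ∈ (Finset.univ : Finset (Fin n)).offDiag, if v = B q.1 q.2 then 1 else 0

theorem perm_count {n : ℕ} (B : Fin n → Fin n → Bool) (v : Bool)
    (p : Fin n × Fin n) (hp : p.1 ≠ p.2) :
    n * (n - 1) * (∑ π : Equiv.Perm (Fin n), if v = B (π p.1) (π p.2) then 1 else 0)
      = Fintype.card (Equiv.Perm (Fin n)) * offCount B v := by
  have h1 : ∀ q ∈ (Finset.univ : Finset (Fin n)).offDiag,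
      (∑ π : Equiv.Perm (Fin n), if v = B (π q.1) (π q.2) then 1 else 0)
      = ∑ π : Equiv.Perm (Fin n), if v = B (π p.1) (π p.2) then 1 else 0 := by
    intro q hq
    have hq' : q.1 ≠ q.2 := by simpa using hq
    obtain ⟨g, hg1, hg2⟩ := MulAction.is_two_pretransitive_iff.1
      (Equiv.Perm.isMultiplyPretransitive (Fin n) 2) hp hq'
    rw [← hg1, ← hg2]
    exact Fintype.sum_equiv (Equiv.mulRight g) _ _ (fun π => rfl)
  have h2 : ∀ π : Equiv.Perm (Fin n),
      (∑ q ∈ (Finset.univ : Finset (Fin n)).offDiag,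
        if v = B (π q.1) (π q.2) then 1 else 0) = offCount B v := by
    intro π
    unfold offCount
    refine Finset.sum_equiv (Equiv.prodCongr π π) ?_ ?_
    · intro q; simp
    · intro q _; rfl
  have h3 := Finset.sum_congr rfl h1
  rw [Finset.sum_comm, Finset.sum_congr rfl (fun π _ => h2 π)] at h3
  simp only [Finset.sum_const, Finset.offDiag_card, Finset.card_univ, Fintype.card_fin,
    smul_eq_mul] at h3
  rw [h3, Nat.mul_sub_one]

theorem offCount_true {n : ℕ} (B : Fin n → Fin n → Bool) :
    offCount B true = (Finset.univ.filter fun p : Fin n × Fin n =>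
      p.1 ≠ p.2 ∧ B p.1 p.2 = true).card := by
  unfold offCount
  rw [← Finset.card_filter]
  congr 1
  ext p
  simp only [Finset.mem_filter, Finset.mem_offDiag, Finset.mem_univ, true_and, ne_eq]
  rw [@eq_comm _ true]

theorem offCount_add {n : ℕ} (B : Fin n → Fin n → Bool) :
    offCount B true + offCount B false = n * (n - 1) := by
  unfold offCount
  rw [← Finset.sum_add_distrib, Finset.sum_congr rfl (g := fun _ => 1)]
  · simp [Nat.mul_sub_one]
  · intro q _
    cases B q.1 q.2 <;> rfl

/-- Expected count of positions where a randomly permuted parent confirms an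
error: with `w₁`, `w₀` the numbers of off-diagonal positions where `A` is `true`
but `Opt` is `false` (resp. `A` is `false` but `Opt` is `true`), and `b₁`, `b₀`
the numbers of off-diagonal `true`/`false` entries of `B`, the expected number
of off-diagonal positions where `A` agrees with `B^π` but differs from `Opt`,
for `π` uniform over permutations, equals `(w₁·b₁ + w₀·b₀)/(n(n−1))`. -/
theorem expected_confirmed_errors_random_permutation {n : ℕ} (hn : 2 ≤ n)
    (Opt A B : Fin n → Fin n → Bool) (w₁ w₀ b₁ b₀ : ℕ)
    (hw₁ : w₁ = (Finset.univ.filter fun p : Fin n × Fin n =>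
      p.1 ≠ p.2 ∧ A p.1 p.2 = true ∧ Opt p.1 p.2 = false).card)
    (hw₀ : w₀ = (Finset.univ.filter fun p : Fin n × Fin n =>
      p.1 ≠ p.2 ∧ A p.1 p.2 = false ∧ Opt p.1 p.2 = true).card)
    (hb₁ : b₁ = (Finset.univ.filter fun p : Fin n × Fin n =>
      p.1 ≠ p.2 ∧ B p.1 p.2 = true).card)
    (hb₀ : b₀ = n * (n - 1) - b₁) :
    ∫ π : Equiv.Perm (Fin n),
        (((Finset.univ.filter fun p : Fin n × Fin n =>
          p.1 ≠ p.2 ∧ A p.1 p.2 = conj π B p.1 p.2 ∧ A p.1 p.2 ≠ Opt p.1 p.2).card : ℕ) : ℝ)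
        ∂(PMF.uniformOfFintype (Equiv.Perm (Fin n))).toMeasure =
      ((w₁ * b₁ + w₀ * b₀ : ℕ) : ℝ) / ((n * (n - 1) : ℕ) : ℝ) := by
  have hb1 : b₁ = offCount B true := by rw [hb₁, offCount_true]
  have hb0 : b₀ = offCount B false := by
    have := offCount_add B
    omega
  have key : n * (n - 1) * (∑ π : Equiv.Perm (Fin n), (Finset.univ.filter
      fun p : Fin n × Fin n => p.1 ≠ p.2 ∧ A p.1 p.2 = conj π B p.1 p.2 ∧
        A p.1 p.2 ≠ Opt p.1 p.2).card)
      = Fintype.card (Equiv.Perm (Fin n)) * (w₁ * b₁ + w₀ * b₀) := by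
    simp only [Finset.card_filter] at hw₁ hw₀ ⊢
    rw [Finset.sum_comm, hw₁, hw₀, Finset.sum_mul, Finset.sum_mul, ← Finset.sum_add_distrib,
      Finset.mul_sum, Finset.mul_sum]
    refine Finset.sum_congr rfl fun p _ => ?_
    by_cases hp : p.1 = p.2
    · simp [hp]
    have ht := perm_count B true p hp
    have hf := perm_count B false p hp
    rw [← hb1] at ht
    rw [← hb0] at hf
    unfold conj
    cases hA : A p.1 p.2 <;> cases hO : Opt p.1 p.2
    · simp
    · simpa [hp] using hf
    · simpa [hp] using ht
    · simp
  have hN : (0 : ℝ) < ((n * (n - 1) : ℕ) : ℝ) := by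
    have : 0 < n * (n - 1) := Nat.mul_pos (by omega) (by omega)
    exact_mod_cast this
  have hF : (0 : ℝ) < (Fintype.card (Equiv.Perm (Fin n)) : ℝ) := by
    exact_mod_cast Fintype.card_pos
  have : MeasurableSingletonClass (Equiv.Perm (Fin n)) := ⟨fun _ => trivial⟩
  rw [PMF.integral_eq_sum]
  simp only [PMF.uniformOfFintype_apply, ENNReal.toReal_inv, ENNReal.toReal_natCast, smul_eq_mul]
  rw [← Finset.mul_sum, ← Nat.cast_sum, inv_mul_eq_div, div_eq_div_iff hF.ne' hN.ne']
  rw [← Nat.cast_mul, ← Nat.cast_mul, mul_comm, key, mul_comm]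
end

section
/- Expected offspring error of standard crossover: let Opt, A, B be n × n matrices with Boolean entries, n ≥ 2, write N = n(n−1), d = d_e(Opt, A); let a₁, o₁, b₁ be the numbers of off-diagonal true entries of A, Opt, B respectively, and a₀ = N − a₁, o₀ = N − o₁, b₀ = N − b₁. If the choice mask c is drawn uniformly from all functions Fin n → Fin n → Bool and, independently, π is drawn uniformly from the permutations of Fin n, then the expected value of d_e(Opt, rec c A (B^π)) equals ((d + a₁ − o₁)·b₁ + (d + a₀ − o₀)·b₀) / (2N) + (a₁·b₀ + a₀·b₁) / (2N). -/
open Finset MeasureTheory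

lemma aux_de_eq {n : ℕ} (X Y : Fin n → Fin n → Bool) :
    (de X Y : ℝ) = ∑ p ∈ Finset.univ.filter (fun p : Fin n × Fin n => p.1 ≠ p.2),
      if X p.1 p.2 ≠ Y p.1 p.2 then (1 : ℝ) else 0 := by
  unfold de
  rw [← Finset.filter_filter, Finset.card_filter]
  push_cast
  rfl

lemma aux_count_eq {n : ℕ} (X : Fin n → Fin n → Bool) :
    (((Finset.univ.filter fun p : Fin n × Fin n =>
      p.1 ≠ p.2 ∧ X p.1 p.2 = true).card : ℕ) : ℝ) =
    ∑ p ∈ Finset.univ.filter (fun p : Fin n × Fin n => p.1 ≠ p.2),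
      if X p.1 p.2 = true then (1 : ℝ) else 0 := by
  rw [← Finset.filter_filter, Finset.card_filter]
  push_cast
  rfl

lemma aux_card_S (n : ℕ) :
    (Finset.univ.filter (fun p : Fin n × Fin n => p.1 ≠ p.2)).card = n * (n - 1) := by
  have h : Finset.univ.filter (fun p : Fin n × Fin n => p.1 ≠ p.2)
      = (Finset.univ : Finset (Fin n)).offDiag := by
    ext p; simp
  rw [h, Finset.offDiag_card]
  simp [Nat.mul_sub]

lemma aux_trans {n : ℕ} (i j k l : Fin n) (h : i ≠ j) (h' : k ≠ l) :
    ∃ τ : Equiv.Perm (Fin n), τ i = k ∧ τ j = l := by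
  refine ⟨Equiv.swap (Equiv.swap i k j) l * Equiv.swap i k, ?_, ?_⟩
  · have h1 : k ≠ Equiv.swap i k j := by
      intro e
      apply h
      apply (Equiv.swap i k).injective
      rw [← e, Equiv.swap_apply_left]
    simp [Equiv.swap_apply_of_ne_of_ne h1 h']
  · simp

lemma aux_indep {n : ℕ} (g : Fin n → Fin n → ℝ) (i j k l : Fin n) (h : i ≠ j) (h' : k ≠ l) :
    ∑ π : Equiv.Perm (Fin n), g (π i) (π j) = ∑ π : Equiv.Perm (Fin n), g (π k) (π l) := by
  obtain ⟨τ, h1, h2⟩ := aux_trans i j k l h h'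
  rw [← Equiv.sum_comp (Equiv.mulRight τ) (fun π : Equiv.Perm (Fin n) => g (π i) (π j))]
  simp [h1, h2]

lemma aux_perm_sum {n : ℕ} (g : Fin n → Fin n → ℝ) (i j : Fin n) (h : i ≠ j) :
    ((n * (n - 1) : ℕ) : ℝ) * ∑ π : Equiv.Perm (Fin n), g (π i) (π j) =
      (Fintype.card (Equiv.Perm (Fin n)) : ℝ) *
        ∑ p ∈ Finset.univ.filter (fun p : Fin n × Fin n => p.1 ≠ p.2), g p.1 p.2 := by
  have e1 : ∑ p ∈ Finset.univ.filter (fun p : Fin n × Fin n => p.1 ≠ p.2),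
      ∑ π : Equiv.Perm (Fin n), g (π p.1) (π p.2) =
      ((n * (n - 1) : ℕ) : ℝ) * ∑ π : Equiv.Perm (Fin n), g (π i) (π j) := by
    rw [← aux_card_S, ← nsmul_eq_mul, ← Finset.sum_const]
    apply Finset.sum_congr rfl
    intro p hp
    exact aux_indep g _ _ _ _ (by simpa using hp) h
  rw [← e1, Finset.sum_comm]
  have e2 : ∀ π : Equiv.Perm (Fin n),
      ∑ p ∈ Finset.univ.filter (fun p : Fin n × Fin n => p.1 ≠ p.2), g (π p.1) (π p.2) =
      ∑ p ∈ Finset.univ.filter (fun p : Fin n × Fin n => p.1 ≠ p.2), g p.1 p.2 := by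
    intro π
    apply Finset.sum_equiv (Equiv.prodCongr π π)
    · intro p; simp
    · intro p _; simp
  simp only [e2, Finset.sum_const, nsmul_eq_mul, Finset.card_univ]

lemma aux_sum_conj {n : ℕ} (X B : Fin n → Fin n → Bool) (o b : ℝ)
    (ho : o = ∑ p ∈ Finset.univ.filter (fun p : Fin n × Fin n => p.1 ≠ p.2),
      if X p.1 p.2 = true then (1 : ℝ) else 0)
    (hb : b = ∑ p ∈ Finset.univ.filter (fun p : Fin n × Fin n => p.1 ≠ p.2),
      if B p.1 p.2 = true then (1 : ℝ) else 0) :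
    ((n * (n - 1) : ℕ) : ℝ) * ∑ π : Equiv.Perm (Fin n), (de X (conj π B) : ℝ) =
      (Fintype.card (Equiv.Perm (Fin n)) : ℝ) *
        (((n * (n - 1) : ℕ) : ℝ) * o + ((n * (n - 1) : ℕ) : ℝ) * b - 2 * o * b) := by
  simp only [aux_de_eq]
  rw [Finset.sum_comm, Finset.mul_sum]
  have key : ∀ p ∈ Finset.univ.filter (fun p : Fin n × Fin n => p.1 ≠ p.2),
      ((n * (n - 1) : ℕ) : ℝ) * ∑ π : Equiv.Perm (Fin n),
        (if X p.1 p.2 ≠ conj π B p.1 p.2 then (1 : ℝ) else 0) =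
      (Fintype.card (Equiv.Perm (Fin n)) : ℝ) *
        ((((n * (n - 1) : ℕ) : ℝ) - 2 * b) * (if X p.1 p.2 = true then (1 : ℝ) else 0) + b) := by
    intro p hp
    have hp' : p.1 ≠ p.2 := by simpa using hp
    have h := aux_perm_sum (fun i j => if B i j = true then (1 : ℝ) else 0) p.1 p.2 hp'
    rw [← hb] at h
    have h3 : ∀ π : Equiv.Perm (Fin n),
        (if X p.1 p.2 ≠ conj π B p.1 p.2 then (1 : ℝ) else 0) =
        (if X p.1 p.2 = true then (1 : ℝ) else 0) +
        (1 - 2 * (if X p.1 p.2 = true then (1 : ℝ) else 0)) *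
          (if B (π p.1) (π p.2) = true then (1 : ℝ) else 0) := by
      intro π
      unfold conj
      cases X p.1 p.2 <;> cases B (π p.1) (π p.2) <;> norm_num
    simp only [h3, Finset.sum_add_distrib, ← Finset.mul_sum, Finset.sum_const, nsmul_eq_mul,
      Finset.card_univ]
    linear_combination (1 - 2 * (if X p.1 p.2 = true then (1 : ℝ) else 0)) * h
  rw [Finset.sum_congr rfl key, ← Finset.mul_sum, Finset.sum_add_distrib, ← Finset.mul_sum,
    ← ho, Finset.sum_const, aux_card_S, nsmul_eq_mul]
  ring

lemma aux_flip {n : ℕ} (X A Y : Fin n → Fin n → Bool) (c : Fin n → Fin n → Bool) :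
    (de X (recomb c A Y) : ℝ) + de X (recomb (fun i j => !c i j) A Y) = de X A + de X Y := by
  simp only [aux_de_eq, ← Finset.sum_add_distrib]
  apply Finset.sum_congr rfl
  intro p _
  unfold recomb
  cases h : c p.1 p.2 <;> simp [h, add_comm]

lemma aux_sum_mask {n : ℕ} (X A Y : Fin n → Fin n → Bool) :
    2 * ∑ c : Fin n → Fin n → Bool, (de X (recomb c A Y) : ℝ) =
      (Fintype.card (Fin n → Fin n → Bool) : ℝ) * (de X A + de X Y) := by
  have hinv : Function.Involutive (fun (c : Fin n → Fin n → Bool) => fun i j => !c i j) := by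
    intro c; simp
  have h := Equiv.sum_comp hinv.toPerm (fun c => (de X (recomb c A Y) : ℝ))
  have h2 : ∑ c : Fin n → Fin n → Bool, ((de X (recomb c A Y) : ℝ) +
      de X (recomb (fun i j => !c i j) A Y)) = 
      (Fintype.card (Fin n → Fin n → Bool) : ℝ) * (de X A + de X Y) := by
    simp only [aux_flip, Finset.sum_const, nsmul_eq_mul, Finset.card_univ]
  rw [Finset.sum_add_distrib] at h2
  simp only [Function.Involutive.coe_toPerm] at h
  linarith

instance aux_disc {n : ℕ} : DiscreteMeasurableSpace (Equiv.Perm (Fin n)) := ⟨fun _ => trivial⟩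

/-- Expected offspring error of standard crossover: for a uniformly random
choice mask `c` and an independent uniformly random permutation `π`, the
expectation of `d_e(Opt, rec c A (B^π))` equals
`((d + a₁ − o₁)·b₁ + (d + a₀ − o₀)·b₀)/(2N) + (a₁·b₀ + a₀·b₁)/(2N)`. -/
theorem expected_offspring_error_standard_crossover {n : ℕ} (hn : 2 ≤ n)
    (Opt A B : Fin n → Fin n → Bool) (N d a₁ a₀ o₁ o₀ b₁ b₀ : ℕ)
    (hN : N = n * (n - 1))
    (hd : d = de Opt A)
    (ha₁ : a₁ = (Finset.univ.filter fun p : Fin n × Fin n =>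
      p.1 ≠ p.2 ∧ A p.1 p.2 = true).card)
    (ho₁ : o₁ = (Finset.univ.filter fun p : Fin n × Fin n =>
      p.1 ≠ p.2 ∧ Opt p.1 p.2 = true).card)
    (hb₁ : b₁ = (Finset.univ.filter fun p : Fin n × Fin n =>
      p.1 ≠ p.2 ∧ B p.1 p.2 = true).card)
    (ha₀ : a₀ = N - a₁) (ho₀ : o₀ = N - o₁) (hb₀ : b₀ = N - b₁) :
    ∫ q : (Fin n → Fin n → Bool) × Equiv.Perm (Fin n),
        (de Opt (recomb q.1 A (conj q.2 B)) : ℝ)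
        ∂(PMF.uniformOfFintype ((Fin n → Fin n → Bool) × Equiv.Perm (Fin n))).toMeasure =
      (((d : ℝ) + a₁ - o₁) * b₁ + ((d : ℝ) + a₀ - o₀) * b₀) / (2 * N) +
        ((a₁ : ℝ) * b₀ + (a₀ : ℝ) * b₁) / (2 * N) := by
  have hmain := aux_sum_conj Opt B (o₁ : ℝ) (b₁ : ℝ) (by rw [ho₁, aux_count_eq])
    (by rw [hb₁, aux_count_eq])
  have hle : ∀ X : Fin n → Fin n → Bool, (Finset.univ.filter fun p : Fin n × Fin n =>
      p.1 ≠ p.2 ∧ X p.1 p.2 = true).card ≤ N := by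
    intro X
    rw [hN, ← aux_card_S, ← Finset.filter_filter]
    exact Finset.card_filter_le _ _
  have hA : (a₀ : ℝ) = N - a₁ := by rw [ha₀, Nat.cast_sub (ha₁ ▸ hle A)]
  have hO : (o₀ : ℝ) = N - o₁ := by rw [ho₀, Nat.cast_sub (ho₁ ▸ hle Opt)]
  have hB : (b₀ : ℝ) = N - b₁ := by rw [hb₀, Nat.cast_sub (hb₁ ▸ hle B)]
  have hNpos : (N : ℝ) ≠ 0 := by
    have : 0 < N := by rw [hN]; exact Nat.mul_pos (by omega) (by omega)
    exact_mod_cast this.ne'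
  rw [← hN] at hmain
  rw [PMF.integral_eq_sum]
  simp only [PMF.uniformOfFintype_apply, smul_eq_mul, ENNReal.toReal_inv, ENNReal.toReal_natCast]
  rw [← Finset.mul_sum, Fintype.sum_prod_type_right, Fintype.card_prod]
  have h2 : 2 * ∑ π : Equiv.Perm (Fin n), ∑ c : Fin n → Fin n → Bool,
      (de Opt (recomb c A (conj π B)) : ℝ) =
      (Fintype.card (Fin n → Fin n → Bool) : ℝ) *
        ((Fintype.card (Equiv.Perm (Fin n)) : ℝ) * d +
          ∑ π : Equiv.Perm (Fin n), (de Opt (conj π B) : ℝ)) := by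
    rw [Finset.mul_sum]
    simp only [aux_sum_mask, ← Finset.mul_sum, Finset.sum_add_distrib, Finset.sum_const,
      nsmul_eq_mul, Finset.card_univ, hd]
  have hC : (Fintype.card (Fin n → Fin n → Bool) : ℝ) ≠ 0 := by
    exact_mod_cast Fintype.card_ne_zero
  have hP : (Fintype.card (Equiv.Perm (Fin n)) : ℝ) ≠ 0 := by
    exact_mod_cast Fintype.card_ne_zero
  rw [hA, hO, hB, Nat.cast_mul]
  generalize (Fintype.card (Fin n → Fin n → Bool) : ℝ) = C at *
  generalize (Fintype.card (Equiv.Perm (Fin n)) : ℝ) = P at *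
  generalize (∑ π : Equiv.Perm (Fin n), ∑ c : Fin n → Fin n → Bool,
      (de Opt (recomb c A (conj π B)) : ℝ)) = S at *
  generalize (∑ π : Equiv.Perm (Fin n), (de Opt (conj π B) : ℝ)) = T at *
  field_simp
  linear_combination (N : ℝ) * h2 + C * hmain
end
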